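/- Under the hypotheses that Qx ≥ p is a box-TDI system (Q integral with columns indexed by a finite set S, p integral) defining a nonempty integral polyhedron R with Φ finite-valued on ⊙R := R ∩ ℤ^S, an element z* ∈ ⊙R is a Φ-minimizer of ⊙R if and only if there exists a nonnegative integer-valued vector y* satisfying the optimality criteria: y*(Qz* − p) = 0 and Φ'(z* − 1) ≤ y*Q ≤ Φ'(z*). -/

import Mathlib

open Matrix

/-- A rational linear system `A x ≥ b` is totally dual integral (TDI): for every integral
cost vector `c` for which the dual program `max {y b : y ≥ 0, y A = c}` is feasible and
bounded, the maximum is attained by an integral vector `y`. -/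
def IsTDI {ι κ : Type} [Fintype ι] [Fintype κ] (A : Matrix ι κ ℚ) (b : ι → ℚ) : Prop :=
  ∀ c : κ → ℤ,
    (∃ y : ι → ℚ, 0 ≤ y ∧ y ᵥ* A = fun j => (c j : ℚ)) →
    (∃ M : ℚ, ∀ y : ι → ℚ, 0 ≤ y → (y ᵥ* A = fun j => (c j : ℚ)) → y ⬝ᵥ b ≤ M) →
    ∃ y : ι → ℚ, (∀ i, ∃ z : ℤ, y i = z) ∧ 0 ≤ y ∧ (y ᵥ* A = fun j => (c j : ℚ)) ∧
      ∀ y' : ι → ℚ, 0 ≤ y' → (y' ᵥ* A = fun j => (c j : ℚ)) → y' ⬝ᵥ b ≤ y ⬝ᵥ b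

/-- The coefficient matrix of the system `[A x ≥ b, x ≥ f, -x ≥ -g]`. -/
def boxMatrix {ι κ : Type} [DecidableEq κ] (A : Matrix ι κ ℚ) : Matrix (ι ⊕ (κ ⊕ κ)) κ ℚ :=
  Matrix.of fun i j =>
    match i with
    | Sum.inl i => A i j
    | Sum.inr (Sum.inl i) => if i = j then 1 else 0
    | Sum.inr (Sum.inr i) => if i = j then -1 else 0

/-- The right-hand side of the system `[A x ≥ b, x ≥ f, -x ≥ -g]`. -/
def boxRHS {ι κ : Type} (b : ι → ℚ) (f g : κ → ℚ) : ι ⊕ (κ ⊕ κ) → ℚ :=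
  Sum.elim b (Sum.elim f fun j => -(g j))

/-- A rational linear system `A x ≥ b` is box-TDI: for all rational finite-valued
bounding vectors `f ≤ g`, the system `[A x ≥ b, f ≤ x ≤ g]` is TDI. -/
def IsBoxTDI {ι κ : Type} [Fintype ι] [Fintype κ] [DecidableEq κ]
    (A : Matrix ι κ ℚ) (b : ι → ℚ) : Prop :=
  ∀ f g : κ → ℚ, f ≤ g → IsTDI (boxMatrix A) (boxRHS b f g)

/-- Membership in the polyhedron `R = {x : Q x ≥ p}`. -/
def memR {m : ℕ} {S : Type} [Fintype S] (Q : Matrix (Fin m) S ℤ) (p : Fin m → ℤ)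
    (x : S → ℚ) : Prop :=
  (fun i => (p i : ℚ)) ≤ (Q.map (Int.cast : ℤ → ℚ)) *ᵥ x

/-- The separable function `Φ(z) = Σ_s φ_s(z(s))`, valued in `ℤ ∪ {+∞}`. -/
def PhiSum {S : Type} [Fintype S] (φ : S → ℤ → WithTop ℤ) (z : S → ℤ) : WithTop ℤ :=
  ∑ s, φ s (z s)

/-- Farkas' lemma for finitely many linear functionals. -/
theorem exists_nonneg_combination_of_forall_nonneg {ι W : Type*} [AddCommGroup W] [Module ℚ W]
    (s : Finset ι) (a : ι → W →ₗ[ℚ] ℚ) (b : W →ₗ[ℚ] ℚ)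
    (h : ∀ x, (∀ i ∈ s, 0 ≤ a i x) → 0 ≤ b x) :
    ∃ l : ι → ℚ, 0 ≤ l ∧ ∀ x, b x = ∑ i ∈ s, l i * a i x := by
  classical
  induction s using Finset.induction_on generalizing a b with
  | empty =>
    refine ⟨0, le_rfl, fun x => ?_⟩
    have h1 := h x (by simp)
    have h2 := h (-x) (by simp)
    simp only [map_neg] at h2
    simp only [Finset.sum_empty]
    linarith
  | insert i₀ s hi ih =>
    by_cases hs : ∀ x, (∀ i ∈ s, 0 ≤ a i x) → 0 ≤ b x
    · obtain ⟨l, hl, hb⟩ := ih a b hs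
      refine ⟨Function.update l i₀ 0, ?_, fun x => ?_⟩
      · intro i
        by_cases hii : i = i₀
        · subst hii; simp
        · simpa [hii] using hl i
      · rw [Finset.sum_insert hi, hb x, Function.update_self, zero_mul, zero_add]
        refine Finset.sum_congr rfl fun i his => ?_
        rw [Function.update_of_ne (ne_of_mem_of_not_mem his hi)]
    · push Not at hs
      obtain ⟨x₁, hx₁, hbx₁⟩ := hs
      have hneg : a i₀ x₁ < 0 := by
        by_contra hcon
        push Not at hcon
        have := h x₁ (by
          intro i hi'
          rcases Finset.mem_insert.1 hi' with rfl | hi'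
          · exact hcon
          · exact hx₁ i hi')
        linarith
      obtain ⟨x₀, hx₀, hbx₀, hax₀⟩ :
          ∃ x₀, (∀ i ∈ s, 0 ≤ a i x₀) ∧ b x₀ < 0 ∧ a i₀ x₀ = -1 := by
        have hpos : 0 < (-(a i₀ x₁))⁻¹ := inv_pos.2 (by linarith)
        refine ⟨(-(a i₀ x₁))⁻¹ • x₁, fun i his => ?_, ?_, ?_⟩
        · rw [map_smul, smul_eq_mul]
          exact mul_nonneg hpos.le (hx₁ i his)
        · rw [map_smul, smul_eq_mul]
          exact mul_neg_of_pos_of_neg hpos hbx₁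
        · rw [map_smul, smul_eq_mul, inv_neg, neg_mul, inv_mul_cancel₀ hneg.ne]
      let π : W →ₗ[ℚ] W := LinearMap.id + (a i₀).smulRight x₀
      have hπ : ∀ (φ : W →ₗ[ℚ] ℚ) x, φ (π x) = φ x + a i₀ x * φ x₀ := by
        intro φ x
        simp [π]
      obtain ⟨l, hl, hb⟩ := ih (fun i => (a i).comp π) (b.comp π) (by
        intro x hx
        refine h (π x) fun i hi' => ?_
        rcases Finset.mem_insert.1 hi' with rfl | hi'
        · rw [hπ, hax₀]; linarith
        · exact hx i hi')
      have hsum : 0 ≤ ∑ i ∈ s, l i * a i x₀ :=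
        Finset.sum_nonneg fun i his => mul_nonneg (hl i) (hx₀ i his)
      refine ⟨Function.update l i₀ (∑ i ∈ s, l i * a i x₀ - b x₀), ?_, fun x => ?_⟩
      · intro i
        by_cases hii : i = i₀
        · subst hii
          simp only [Pi.zero_apply, Function.update_self]
          linarith
        · simpa [hii] using hl i
      · have hbx := hb x
        simp only [LinearMap.comp_apply, hπ] at hbx
        have e1 : ∑ i ∈ s, Function.update l i₀ (∑ i ∈ s, l i * a i x₀ - b x₀) i * a i x =
            ∑ i ∈ s, l i * a i x := by
          refine Finset.sum_congr rfl fun i his => ?_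
          rw [Function.update_of_ne (ne_of_mem_of_not_mem his hi)]
        have e2 : ∑ i ∈ s, l i * (a i x + a i₀ x * a i x₀) =
            ∑ i ∈ s, l i * a i x + a i₀ x * ∑ i ∈ s, l i * a i x₀ := by
          rw [Finset.mul_sum, ← Finset.sum_add_distrib]
          exact Finset.sum_congr rfl fun i _ => by ring
        rw [Finset.sum_insert hi, Function.update_self, e1]
        rw [e2] at hbx
        linarith

/-- Farkas' lemma for infeasible systems of linear inequalities. -/
theorem exists_vecMul_eq_zero_of_infeasible {ι κ : Type*} [Fintype ι] [Fintype κ]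
    (A : Matrix ι κ ℚ) (b : ι → ℚ) (h : ∀ x, ¬ b ≤ A *ᵥ x) :
    ∃ y : ι → ℚ, 0 ≤ y ∧ y ᵥ* A = 0 ∧ 0 < y ⬝ᵥ b := by
  classical
  obtain ⟨l, hl, hb⟩ := exists_nonneg_combination_of_forall_nonneg (W := (κ → ℚ) × ℚ)
    Finset.univ
    (fun i : ι => (LinearMap.proj i ∘ₗ A.mulVecLin ∘ₗ LinearMap.fst ℚ (κ → ℚ) ℚ) -
      b i • LinearMap.snd ℚ (κ → ℚ) ℚ)
    (-LinearMap.snd ℚ (κ → ℚ) ℚ) (by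
      rintro ⟨x, t⟩ hx
      by_contra hneg
      have ht : 0 < t := by simpa using hneg
      refine h (t⁻¹ • x) fun i => ?_
      have := hx i (Finset.mem_univ i)
      simp only [LinearMap.sub_apply, LinearMap.comp_apply, LinearMap.fst_apply,
        LinearMap.smul_apply, LinearMap.snd_apply, Matrix.mulVecLin_apply, LinearMap.proj_apply,
        smul_eq_mul, sub_nonneg] at this
      rw [Matrix.mulVec_smul, Pi.smul_apply, smul_eq_mul, inv_mul_eq_div, le_div_iff₀ ht]
      exact this)
  refine ⟨l, hl, ?_, ?_⟩
  · funext j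
    have := hb (Pi.single j 1, 0)
    simpa [Matrix.vecMul, dotProduct] using this.symm
  · have := hb (0, 1)
    simp only [LinearMap.neg_apply, LinearMap.snd_apply, LinearMap.sub_apply,
      LinearMap.comp_apply, LinearMap.fst_apply, map_zero, LinearMap.smul_apply, smul_eq_mul,
      zero_sub, mul_neg, mul_one, Finset.sum_neg_distrib, neg_inj] at this
    rw [dotProduct, ← this]
    exact one_pos

/-- Farkas' lemma for a system split into lower and upper bounds. -/
theorem exists_vecMul_eq_of_infeasible {ι κ τ : Type*} [Fintype ι] [Fintype κ] [Fintype τ]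
    (A : Matrix ι κ ℚ) (b : ι → ℚ) (C : Matrix τ κ ℚ) (d : τ → ℚ)
    (h : ∀ x, b ≤ A *ᵥ x → ¬ C *ᵥ x ≤ d) :
    ∃ (y : ι → ℚ) (t : τ → ℚ), 0 ≤ y ∧ 0 ≤ t ∧ y ᵥ* A = t ᵥ* C ∧ t ⬝ᵥ d < y ⬝ᵥ b := by
  obtain ⟨w, hw, hwA, hwb⟩ := exists_vecMul_eq_zero_of_infeasible
    (Matrix.fromRows A (-C)) (Sum.elim b (-d)) (by
      intro x hx
      rw [Matrix.fromRows_mulVec] at hx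
      refine h x (fun i => hx (Sum.inl i)) fun i => ?_
      have := hx (Sum.inr i)
      simpa [Matrix.neg_mulVec] using this)
  refine ⟨w ∘ Sum.inl, w ∘ Sum.inr, fun i => hw _, fun i => hw _, ?_, ?_⟩
  · rw [Matrix.vecMul_fromRows, Matrix.vecMul_neg] at hwA
    exact add_neg_eq_zero.1 hwA
  · simp only [dotProduct, Fintype.sum_sum_type, Sum.elim_inl, Sum.elim_inr, Pi.neg_apply,
      mul_neg, Finset.sum_neg_distrib] at hwb
    simp only [dotProduct, Function.comp]
    linarith

/-- Weak duality for linear programs. -/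
theorem dotProduct_le_vecMul_dotProduct {ι κ : Type*} [Fintype ι] [Fintype κ]
    {A : Matrix ι κ ℚ} {b y : ι → ℚ} {x : κ → ℚ} (hy : 0 ≤ y) (hx : b ≤ A *ᵥ x) :
    y ⬝ᵥ b ≤ (y ᵥ* A) ⬝ᵥ x := by
  rw [← Matrix.dotProduct_mulVec]
  exact dotProduct_le_dotProduct_of_nonneg_left hx hy

/-- A feasible TDI system with dual feasible integral cost has an integral optimal dual solution
and an optimal primal solution of the same value. -/
theorem IsTDI.exists_optimal {ι κ : Type} [Fintype ι] [Fintype κ] {A : Matrix ι κ ℚ}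
    {b : ι → ℚ} (h : IsTDI A b) (c : κ → ℤ) {x₀ : κ → ℚ} (hx₀ : b ≤ A *ᵥ x₀)
    (hc : ∃ y : ι → ℚ, 0 ≤ y ∧ y ᵥ* A = fun j => (c j : ℚ)) :
    ∃ y : ι → ℤ, 0 ≤ y ∧ ((fun i => (y i : ℚ)) ᵥ* A = fun j => (c j : ℚ)) ∧
      (∀ y' : ι → ℚ, 0 ≤ y' → (y' ᵥ* A = fun j => (c j : ℚ)) →
        y' ⬝ᵥ b ≤ (fun i => (y i : ℚ)) ⬝ᵥ b) ∧
      ∃ x, b ≤ A *ᵥ x ∧ (fun j => (c j : ℚ)) ⬝ᵥ x ≤ (fun i => (y i : ℚ)) ⬝ᵥ b := by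
  obtain ⟨y, hyint, hy, hyA, hopt⟩ := h c hc
    ⟨_, fun y hy hyA => hyA ▸ dotProduct_le_vecMul_dotProduct hy hx₀⟩
  choose z hz using hyint
  obtain rfl : y = fun i => (z i : ℚ) := funext hz
  refine ⟨z, fun i => by simpa using hy i, hyA, hopt, ?_⟩
  by_contra hcon
  push Not at hcon
  obtain ⟨w, t, hw, ht, hwA, hwb⟩ := exists_vecMul_eq_of_infeasible A b
    (Matrix.of fun (_ : Unit) j => (c j : ℚ)) (fun _ => (fun i => (z i : ℚ)) ⬝ᵥ b) (by
      intro x hx hle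
      exact absurd (hle ()) (not_le.2 (hcon x hx)))
  have htC : t ᵥ* (Matrix.of fun (_ : Unit) j => (c j : ℚ)) = t () • fun j => (c j : ℚ) := by
    funext j
    simp [Matrix.vecMul, dotProduct]
  have htd : t ⬝ᵥ (fun _ => (fun i => (z i : ℚ)) ⬝ᵥ b) = t () * ((fun i => (z i : ℚ)) ⬝ᵥ b) := by
    simp [dotProduct]
  rw [htC] at hwA
  rw [htd] at hwb
  rcases (ht ()).eq_or_lt with h0 | hpos
  · have := dotProduct_le_vecMul_dotProduct hw hx₀
    rw [hwA, ← h0] at this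
    rw [← h0] at hwb
    simp at this hwb
    linarith
  · have hpos' : 0 < t () := hpos
    have := hopt ((t ())⁻¹ • w) (smul_nonneg (inv_pos.2 hpos').le hw) (by
      rw [Matrix.smul_vecMul, hwA, smul_smul, inv_mul_cancel₀ hpos'.ne', one_smul])
    rw [smul_dotProduct, smul_eq_mul, inv_mul_le_iff₀ hpos'] at this
    linarith

theorem boxMatrix_mulVec {ι κ : Type} [Fintype κ] [DecidableEq κ] (A : Matrix ι κ ℚ)
    (x : κ → ℚ) : boxMatrix A *ᵥ x = Sum.elim (A *ᵥ x) (Sum.elim x (-x)) := by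
  funext i
  rcases i with i | i | i <;> simp [boxMatrix, Matrix.mulVec, dotProduct]

theorem vecMul_boxMatrix {ι κ : Type} [Fintype ι] [Fintype κ] [DecidableEq κ]
    (A : Matrix ι κ ℚ) (y : ι → ℚ) (u v : κ → ℚ) :
    Sum.elim y (Sum.elim u v) ᵥ* boxMatrix A = y ᵥ* A + u - v := by
  funext j
  simp [boxMatrix, Matrix.vecMul, dotProduct, Fintype.sum_sum_type]
  ring

theorem boxRHS_le_iff {ι κ : Type} [Fintype κ] [DecidableEq κ] (A : Matrix ι κ ℚ)
    (b : ι → ℚ) (f g x : κ → ℚ) :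
    boxRHS b f g ≤ boxMatrix A *ᵥ x ↔ b ≤ A *ᵥ x ∧ f ≤ x ∧ x ≤ g := by
  rw [boxMatrix_mulVec]
  simp [boxRHS, Pi.le_def]

theorem exists_vecMul_boxMatrix_eq {ι κ : Type} [Fintype ι] [Fintype κ] [DecidableEq κ]
    (A : Matrix ι κ ℚ) (c : κ → ℚ) :
    ∃ y : ι ⊕ (κ ⊕ κ) → ℚ, 0 ≤ y ∧ y ᵥ* boxMatrix A = c := by
  refine ⟨Sum.elim 0 (Sum.elim (c ⊔ 0) (-c ⊔ 0)), ?_, ?_⟩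
  · rintro (i | i | i) <;> simp
  · rw [vecMul_boxMatrix]
    funext j
    rcases le_total (c j) 0 with h | h <;> simp [h]

/-- In the intersection of a box-TDI polyhedron with an integral box, any given coordinate of a
point can be made integral without raising an integral cost. -/
theorem IsBoxTDI.exists_le_coord_eq_int {ι κ : Type} [Fintype ι] [Fintype κ] [DecidableEq κ]
    {A : Matrix ι κ ℚ} {b : ι → ℤ} (hbox : IsBoxTDI A fun i => (b i : ℚ)) (c f g : κ → ℤ)
    (s : κ) {x₀ : κ → ℚ}
    (hx₀ : boxRHS (fun i => (b i : ℚ)) (fun j => (f j : ℚ)) (fun j => (g j : ℚ)) ≤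
      boxMatrix A *ᵥ x₀) :
    ∃ (x : κ → ℚ) (k : ℤ),
      boxRHS (fun i => (b i : ℚ)) (fun j => (f j : ℚ)) (fun j => (g j : ℚ)) ≤
        boxMatrix A *ᵥ x ∧
      (fun j => (c j : ℚ)) ⬝ᵥ x ≤ (fun j => (c j : ℚ)) ⬝ᵥ x₀ ∧ x s = k := by
  obtain ⟨-, hf₀, hg₀⟩ := (boxRHS_le_iff _ _ _ _ _).1 hx₀
  have htdi := hbox _ _ (hf₀.trans hg₀)
  obtain ⟨β, hβ⟩ : ∃ β : ι ⊕ (κ ⊕ κ) → ℤ,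
      boxRHS (fun i => (b i : ℚ)) (fun j => (f j : ℚ)) (fun j => (g j : ℚ)) =
        fun i => (β i : ℚ) := by
    refine ⟨Sum.elim b (Sum.elim f (-g)), ?_⟩
    funext i
    rcases i with i | i | i <;> simp [boxRHS]
  rw [hβ] at htdi hx₀ ⊢
  have hval : ∀ y : ι ⊕ (κ ⊕ κ) → ℤ,
      (fun i => (y i : ℚ)) ⬝ᵥ (fun i => (β i : ℚ)) = ((y ⬝ᵥ β : ℤ) : ℚ) := by
    intro y
    simp [dotProduct]
  obtain ⟨y, hy, hyA, -, x₁, hx₁, hcx₁⟩ :=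
    htdi.exists_optimal c hx₀ (exists_vecMul_boxMatrix_eq A _)
  rw [hval] at hcx₁
  have hyq : (0 : ι ⊕ (κ ⊕ κ) → ℚ) ≤ fun i => (y i : ℚ) := fun i => by
    simpa using hy i
  have hlow : ∀ x, (fun i => (β i : ℚ)) ≤ boxMatrix A *ᵥ x →
      ((y ⬝ᵥ β : ℤ) : ℚ) ≤ (fun j => (c j : ℚ)) ⬝ᵥ x := by
    intro x hx
    have := dotProduct_le_vecMul_dotProduct hyq hx
    rwa [hyA, hval] at this
  set k := y ⬝ᵥ β
  set j := ⌊x₁ s⌋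
  have hsum : ∀ (N : ℤ) (x : κ → ℚ),
      (fun j => ((N • c + Pi.single s 1 : κ → ℤ) j : ℚ)) ⬝ᵥ x =
        N * ((fun j => (c j : ℚ)) ⬝ᵥ x) + x s := by
    intro N x
    have e : (fun j => ((N • c + Pi.single s 1 : κ → ℤ) j : ℚ)) =
        (N : ℚ) • (fun j => (c j : ℚ)) + Pi.single s 1 := by
      funext i
      by_cases hi : i = s
      · subst hi; simp
      · simp [hi]
    rw [e, add_dotProduct, smul_dotProduct, single_dotProduct]
    simp
  obtain ⟨x₂, hx₂, hcx₂, hsx₂⟩ : ∃ x, (fun i => (β i : ℚ)) ≤ boxMatrix A *ᵥ x ∧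
      (fun j => (c j : ℚ)) ⬝ᵥ x ≤ k ∧ x s ≤ j := by
    by_contra hcon
    push Not at hcon
    obtain ⟨w, t, hw, ht, hwA, hwb⟩ := exists_vecMul_eq_of_infeasible (boxMatrix A)
      (fun i => (β i : ℚ))
      (Matrix.of fun (r : Bool) i => if r then (c i : ℚ) else (Pi.single s 1 : κ → ℚ) i)
      (fun r => if r then (k : ℚ) else j) (by
        intro x hx hle
        refine absurd (hcon x hx ?_) (not_lt.2 ?_)
        · simpa [Matrix.mulVec, dotProduct] using hle true
        · simpa [Matrix.mulVec, dotProduct, Pi.single_apply] using hle false)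
    have hwx : ∀ x, (w ᵥ* boxMatrix A) ⬝ᵥ x =
        t true * ((fun j => (c j : ℚ)) ⬝ᵥ x) + t false * x s := by
      intro x
      rw [hwA, ← Matrix.dotProduct_mulVec]
      simp [Matrix.mulVec, dotProduct, Pi.single_apply]
    have hwb' : t true * k + t false * j < w ⬝ᵥ fun i => (β i : ℚ) := by
      simpa [dotProduct] using hwb
    have key : ∀ x, (fun i => (β i : ℚ)) ≤ boxMatrix A *ᵥ x →
        t true * k + t false * j < t true * ((fun j => (c j : ℚ)) ⬝ᵥ x) + t false * x s := by
      intro x hx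
      rw [← hwx]
      exact hwb'.trans_le (dotProduct_le_vecMul_dotProduct hw hx)
    have htt : 0 ≤ t true := ht true
    have htf : 0 < t false := by
      refine lt_of_le_of_ne (ht false) fun h0 => ?_
      have := key x₁ hx₁
      rw [← h0] at this
      have := mul_le_mul_of_nonneg_left hcx₁ htt
      linarith
    obtain ⟨N, hN⟩ := exists_nat_ge (t true / t false)
    rw [div_le_iff₀ htf] at hN
    obtain ⟨y', hy', hyA', -, x₃, hx₃, hcx₃⟩ :=
      htdi.exists_optimal ((N : ℤ) • c + Pi.single s 1) hx₀ (exists_vecMul_boxMatrix_eq A _)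
    have hy'1 : ((y' ⬝ᵥ β : ℤ) : ℚ) < N * k + (j + 1) := by
      have h1 := dotProduct_le_vecMul_dotProduct (y := fun i => (y' i : ℚ))
        (fun i => by simpa using hy' i) hx₁
      rw [hyA', hsum, hval] at h1
      have h2 := Int.lt_floor_add_one (x₁ s)
      have h3 := mul_le_mul_of_nonneg_left hcx₁ (Nat.cast_nonneg (α := ℚ) N)
      push_cast at h1
      linarith
    have hy'2 : (N * k + j : ℚ) < ((y' ⬝ᵥ β : ℤ) : ℚ) := by
      rw [hsum, hval] at hcx₃
      have h1 := key x₃ hx₃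
      have h2 := hlow x₃ hx₃
      have h3 : 0 ≤ (N * t false - t true) * ((fun j => (c j : ℚ)) ⬝ᵥ x₃ - k) :=
        mul_nonneg (by linarith) (by linarith)
      refine lt_of_lt_of_le ?_ hcx₃
      refine lt_of_mul_lt_mul_left ?_ htf.le
      push_cast
      nlinarith
    have h1 : y' ⬝ᵥ β < N * k + (j + 1) := by exact_mod_cast hy'1
    have h2 : N * k + j < y' ⬝ᵥ β := by exact_mod_cast hy'2
    omega
  have hx₁s : (j : ℚ) ≤ x₁ s := Int.floor_le _
  obtain ⟨l, hl0, hl1, hl⟩ : ∃ l : ℚ, 0 ≤ l ∧ l ≤ 1 ∧ (1 - l) * x₂ s + l * x₁ s = j := by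
    rcases eq_or_lt_of_le (hsx₂.trans hx₁s) with h | h
    · exact ⟨0, le_rfl, zero_le_one, by linarith⟩
    · have hd : 0 < x₁ s - x₂ s := by linarith
      refine ⟨(j - x₂ s) / (x₁ s - x₂ s), div_nonneg (by linarith) hd.le,
        (div_le_one hd).2 (by linarith), ?_⟩
      field_simp
      ring
  refine ⟨(1 - l) • x₂ + l • x₁, j, ?_, ?_, ?_⟩
  · intro i
    rw [Matrix.mulVec_add, Matrix.mulVec_smul, Matrix.mulVec_smul]
    have h1 := mul_le_mul_of_nonneg_left (hx₁ i) hl0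
    have h2 := mul_le_mul_of_nonneg_left (hx₂ i) (sub_nonneg.2 hl1)
    simp only [Pi.add_apply, Pi.smul_apply, smul_eq_mul]
    linarith
  · rw [dotProduct_add, dotProduct_smul, dotProduct_smul, smul_eq_mul, smul_eq_mul]
    have h1 := mul_le_mul_of_nonneg_left hcx₁ hl0
    have h2 := mul_le_mul_of_nonneg_left hcx₂ (sub_nonneg.2 hl1)
    have h3 := hlow x₀ hx₀
    linarith
  · simpa using hl

/-- Over the intersection of a box-TDI polyhedron with an integral box, every integral cost is
minimized by integral points. -/
theorem IsBoxTDI.exists_int_le {ι κ : Type} [Fintype ι] [Fintype κ] [DecidableEq κ]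
    {A : Matrix ι κ ℚ} {b : ι → ℤ} (hbox : IsBoxTDI A fun i => (b i : ℚ)) (c f g : κ → ℤ)
    {x₀ : κ → ℚ} (hx₀ : (fun i => (b i : ℚ)) ≤ A *ᵥ x₀) (hf : (fun j => (f j : ℚ)) ≤ x₀)
    (hg : x₀ ≤ fun j => (g j : ℚ)) :
    ∃ z : κ → ℤ, ((fun i => (b i : ℚ)) ≤ A *ᵥ fun j => (z j : ℚ)) ∧ f ≤ z ∧ z ≤ g ∧
      (fun j => (c j : ℚ)) ⬝ᵥ (fun j => (z j : ℚ)) ≤ (fun j => (c j : ℚ)) ⬝ᵥ x₀ := by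
  have key : ∀ U : Finset κ, ∃ (f' g' : κ → ℤ) (x : κ → ℚ), f ≤ f' ∧ g' ≤ g ∧
      (∀ s ∈ U, f' s = g' s) ∧
      boxRHS (fun i => (b i : ℚ)) (fun j => (f' j : ℚ)) (fun j => (g' j : ℚ)) ≤
        boxMatrix A *ᵥ x ∧
      (fun j => (c j : ℚ)) ⬝ᵥ x ≤ (fun j => (c j : ℚ)) ⬝ᵥ x₀ := by
    intro U
    induction U using Finset.induction_on with
    | empty =>
      exact ⟨f, g, x₀, le_rfl, le_rfl, by simp, (boxRHS_le_iff _ _ _ _ _).2 ⟨hx₀, hf, hg⟩,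
        le_rfl⟩
    | insert s U hs ih =>
      obtain ⟨f', g', x, hff, hgg, hU, hx, hcx⟩ := ih
      obtain ⟨x', k, hx', hcx', hk⟩ := hbox.exists_le_coord_eq_int c f' g' s hx
      obtain ⟨hb', hf', hg'⟩ := (boxRHS_le_iff _ _ _ _ _).1 hx'
      have hfk : f' s ≤ k := by
        have := hf' s
        rw [hk] at this
        beta_reduce at this
        exact_mod_cast this
      have hgk : k ≤ g' s := by
        have := hg' s
        rw [hk] at this
        beta_reduce at this
        exact_mod_cast this
      refine ⟨Function.update f' s k, Function.update g' s k, x', ?_, ?_, ?_,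
        (boxRHS_le_iff _ _ _ _ _).2 ⟨hb', ?_, ?_⟩, hcx'.trans hcx⟩
      · intro i
        by_cases hi : i = s
        · subst hi; simpa using (hff i).trans hfk
        · simpa [hi] using hff i
      · intro i
        by_cases hi : i = s
        · subst hi; simpa using hgk.trans (hgg i)
        · simpa [hi] using hgg i
      · intro i hi
        by_cases his : i = s
        · subst his; simp
        · simpa [his] using hU i ((Finset.mem_insert.1 hi).resolve_left his)
      · intro i
        by_cases hi : i = s
        · subst hi; simp [hk]
        · simpa [hi] using hf' i
      · intro i
        by_cases hi : i = s
        · subst hi; simp [hk]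
        · simpa [hi] using hg' i
  obtain ⟨f', g', x, hff, hgg, hU, hx, hcx⟩ := key Finset.univ
  obtain ⟨hb', hf', hg'⟩ := (boxRHS_le_iff _ _ _ _ _).1 hx
  obtain rfl : f' = g' := funext fun s => hU s (Finset.mem_univ s)
  obtain rfl : x = fun j => (f' j : ℚ) := le_antisymm hg' hf'
  exact ⟨f', hb', hff, hgg, hcx⟩

/-- If no integral unit step from `z₀` inside a box-TDI polyhedron has negative directional cost,
then some rational multiplier certifies optimality of `z₀`. -/
theorem IsBoxTDI.exists_multiplier {ι κ : Type} [Fintype ι] [Fintype κ] [DecidableEq κ]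
    {A : Matrix ι κ ℚ} {b : ι → ℤ} (hbox : IsBoxTDI A fun i => (b i : ℚ)) {z₀ : κ → ℤ}
    (hz₀ : (fun i => (b i : ℚ)) ≤ A *ᵥ fun j => (z₀ j : ℚ)) {α β : κ → ℤ} (hαβ : α ≤ β)
    (H : ∀ z : κ → ℤ, ((fun i => (b i : ℚ)) ≤ A *ᵥ fun j => (z j : ℚ)) →
      (∀ s, |z s - z₀ s| ≤ 1) →
      0 ≤ ∑ s, max (β s * (z s - z₀ s)) (α s * (z s - z₀ s))) :
    ∃ y : ι → ℚ, 0 ≤ y ∧ y ⬝ᵥ (A *ᵥ (fun j => (z₀ j : ℚ)) - fun i => (b i : ℚ)) ≤ 0 ∧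
      (fun j => (α j : ℚ)) ≤ y ᵥ* A ∧ y ᵥ* A ≤ fun j => (β j : ℚ) := by
  classical
  by_contra hcon
  set σ : ι → ℚ := A *ᵥ (fun j => (z₀ j : ℚ)) - fun i => (b i : ℚ) with hσ
  have hσ0 : 0 ≤ σ := sub_nonneg.2 hz₀
  obtain ⟨w, t, hw, ht, hwt, hlt⟩ := exists_vecMul_eq_of_infeasible
    (Matrix.fromRows (1 : Matrix ι ι ℚ) Aᵀ) (Sum.elim 0 fun j => (α j : ℚ))
    (Matrix.fromRows Aᵀ (Matrix.of fun (_ : Unit) i => σ i))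
    (Sum.elim (fun j => (β j : ℚ)) 0) (by
      intro y h1 h2
      rw [Matrix.fromRows_mulVec, Matrix.one_mulVec, Matrix.mulVec_transpose] at h1
      rw [Matrix.fromRows_mulVec, Matrix.mulVec_transpose] at h2
      refine hcon ⟨y, fun i => h1 (Sum.inl i), ?_, fun j => h1 (Sum.inr j),
        fun j => h2 (Sum.inl j)⟩
      have := h2 (Sum.inr ())
      rw [dotProduct_comm]
      simpa [Matrix.mulVec] using this)
  obtain ⟨η, u, rfl⟩ : ∃ (η : ι → ℚ) (u : κ → ℚ), w = Sum.elim η u :=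
    ⟨w ∘ Sum.inl, w ∘ Sum.inr, (Sum.elim_comp_inl_inr w).symm⟩
  obtain ⟨v, τ, rfl⟩ : ∃ (v : κ → ℚ) (τ : ℚ), t = Sum.elim v fun _ => τ :=
    ⟨t ∘ Sum.inl, t (Sum.inr ()), (Sum.elim_comp_inl_inr t).symm⟩
  have hη : 0 ≤ η := fun i => hw (Sum.inl i)
  have hu : 0 ≤ u := fun i => hw (Sum.inr i)
  have hv : 0 ≤ v := fun i => ht (Sum.inl i)
  have hτ : 0 ≤ τ := ht (Sum.inr ())
  have hlt' : ∑ j, v j * β j < ∑ j, u j * α j := by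
    simpa [dotProduct] using hlt
  set x : κ → ℚ := v - u with hx
  have hAx : ∀ i, (A *ᵥ x) i = η i - τ * σ i := by
    intro i
    have := congrFun hwt i
    simp only [Matrix.vecMul_fromRows, Sum.elim_comp_inl, Sum.elim_comp_inr, Matrix.vecMul_one,
      Matrix.vecMul_transpose, Pi.add_apply] at this
    rw [hx, Matrix.mulVec_sub, Pi.sub_apply]
    have e : ((fun _ => τ) ᵥ* Matrix.of fun (_ : Unit) i => σ i) i = τ * σ i := by
      simp [Matrix.vecMul, dotProduct]
    rw [e] at this
    linarith
  obtain ⟨ε, hε, hετ, hεx⟩ : ∃ ε : ℚ, 0 < ε ∧ ε * τ ≤ 1 ∧ ∀ s, ε * |x s| ≤ 1 := by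
    have hs : 0 ≤ ∑ s, |x s| := Finset.sum_nonneg fun s _ => abs_nonneg _
    have hd : 0 < 1 + τ + ∑ s, |x s| := by linarith
    refine ⟨(1 + τ + ∑ s, |x s|)⁻¹, inv_pos.2 hd, ?_, fun s => ?_⟩
    · rw [inv_mul_le_iff₀ hd]; linarith
    · rw [inv_mul_le_iff₀ hd]
      have := Finset.single_le_sum (f := fun s => |x s|) (fun s _ => abs_nonneg _)
        (Finset.mem_univ s)
      linarith
  set c : κ → ℤ := fun s => if 0 ≤ x s then β s else α s with hc
  obtain ⟨z, hz, hfz, hgz, hcz⟩ := hbox.exists_int_le c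
    (fun s => if 0 ≤ x s then z₀ s else z₀ s - 1) (fun s => if 0 ≤ x s then z₀ s + 1 else z₀ s)
    (x₀ := (fun j => (z₀ j : ℚ)) + ε • x) (by
      intro i
      rw [Matrix.mulVec_add, Matrix.mulVec_smul, Pi.add_apply, Pi.smul_apply, smul_eq_mul, hAx]
      have h1 : (A *ᵥ fun j => (z₀ j : ℚ)) i = σ i + b i := by simp [hσ]
      have h2 : 0 ≤ (1 - ε * τ) * σ i := mul_nonneg (by linarith) (hσ0 i)
      have h3 : 0 ≤ ε * η i := mul_nonneg hε.le (hη i)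
      rw [h1]
      linarith) (by
      intro s
      have := hεx s
      by_cases h : 0 ≤ x s
      · simpa [h] using mul_nonneg hε.le h
      · rw [abs_of_neg (not_le.1 h)] at this
        simp only [h, if_false, Pi.add_apply, Pi.smul_apply, smul_eq_mul]
        push_cast
        linarith) (by
      intro s
      have := hεx s
      by_cases h : 0 ≤ x s
      · rw [abs_of_nonneg h] at this
        simp only [h, if_true, Pi.add_apply, Pi.smul_apply, smul_eq_mul]
        push_cast
        linarith
      · simpa [h] using mul_nonpos_of_nonneg_of_nonpos hε.le (not_le.1 h).le)
  have hsign : ∀ s, (0 ≤ x s ∧ 0 ≤ z s - z₀ s ∧ z s - z₀ s ≤ 1) ∨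
      (¬ 0 ≤ x s ∧ z s - z₀ s ≤ 0 ∧ -1 ≤ z s - z₀ s) := by
    intro s
    have h1 := hfz s
    have h2 := hgz s
    by_cases h : 0 ≤ x s
    · simp only [h, if_true] at h1 h2
      exact Or.inl ⟨h, by omega, by omega⟩
    · simp only [h, if_false] at h1 h2
      exact Or.inr ⟨h, by omega, by omega⟩
  have hH := H z hz fun s => abs_le.2 (by rcases hsign s with h | h <;> omega)
  have hmax : ∑ s, max (β s * (z s - z₀ s)) (α s * (z s - z₀ s)) =
      ∑ s, c s * (z s - z₀ s) := by
    refine Finset.sum_congr rfl fun s _ => ?_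
    rcases hsign s with ⟨h, h1, -⟩ | ⟨h, h1, -⟩
    · simp only [hc, h, if_true]
      exact max_eq_left (mul_le_mul_of_nonneg_right (hαβ s) h1)
    · simp only [hc, h, if_false]
      exact max_eq_right (mul_le_mul_of_nonpos_right (hαβ s) h1)
  rw [hmax] at hH
  have hH' : (0 : ℚ) ≤ ∑ s, (c s : ℚ) * ((z s : ℚ) - z₀ s) := by exact_mod_cast hH
  have hcx : ∑ s, c s * x s ≤ ∑ s, (v s * β s - u s * α s) := by
    refine Finset.sum_le_sum fun s _ => ?_
    have hαβs : (α s : ℚ) ≤ β s := by exact_mod_cast hαβ s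
    by_cases h : 0 ≤ x s
    · simp only [hc, h, if_true]
      rw [hx, Pi.sub_apply]
      have := mul_le_mul_of_nonneg_left hαβs (hu s)
      linarith
    · simp only [hc, h, if_false]
      rw [hx, Pi.sub_apply]
      have := mul_le_mul_of_nonneg_left hαβs (hv s)
      linarith
  rw [dotProduct_add, dotProduct_smul, smul_eq_mul] at hcz
  simp only [dotProduct, mul_sub, Finset.sum_sub_distrib] at hcz hH' hcx
  have := mul_pos_of_neg_of_neg (a := ∑ s, (c s : ℚ) * x s) (b := -ε) (by linarith) (by linarith)
  linarith

/-- Each point of the polyhedron has cost at least that of `z₀` under a complementary multiplier. -/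
theorem vecMul_dotProduct_sub_nonneg {ι κ : Type*} [Fintype ι] [Fintype κ]
    {A : Matrix ι κ ℚ} {b y : ι → ℚ} {x₀ x : κ → ℚ} (hy : 0 ≤ y)
    (hcompl : y ⬝ᵥ (A *ᵥ x₀ - b) ≤ 0) (hx : b ≤ A *ᵥ x) :
    0 ≤ (y ᵥ* A) ⬝ᵥ (x - x₀) := by
  have h1 := dotProduct_le_vecMul_dotProduct hy hx
  rw [dotProduct_sub, Matrix.dotProduct_mulVec] at hcompl
  rw [dotProduct_sub]
  linarith

/-- Rational multipliers between integral bounds can be replaced by integral ones. -/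
theorem IsBoxTDI.exists_int_multiplier {ι κ : Type} [Fintype ι] [Fintype κ] [DecidableEq κ]
    {A : Matrix ι κ ℚ} {b : ι → ℤ} (hbox : IsBoxTDI A fun i => (b i : ℚ)) {z₀ : κ → ℤ}
    (hz₀ : (fun i => (b i : ℚ)) ≤ A *ᵥ fun j => (z₀ j : ℚ)) {α β : κ → ℤ} (y : ι → ℚ)
    (hy : 0 ≤ y)
    (hcompl : y ⬝ᵥ (A *ᵥ (fun j => (z₀ j : ℚ)) - fun i => (b i : ℚ)) ≤ 0)
    (hα : (fun j => (α j : ℚ)) ≤ y ᵥ* A) (hβ : y ᵥ* A ≤ fun j => (β j : ℚ)) :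
    ∃ y : ι → ℤ, 0 ≤ y ∧
      (fun i => (y i : ℚ)) ⬝ᵥ (A *ᵥ (fun j => (z₀ j : ℚ)) - fun i => (b i : ℚ)) ≤ 0 ∧
      (fun j => (α j : ℚ)) ≤ (fun i => (y i : ℚ)) ᵥ* A ∧
      (fun i => (y i : ℚ)) ᵥ* A ≤ fun j => (β j : ℚ) := by
  have key : ∀ U : Finset κ, ∃ (α' β' : κ → ℤ) (y : ι → ℚ), α ≤ α' ∧ β' ≤ β ∧
      (∀ s ∈ U, α' s = β' s) ∧ 0 ≤ y ∧
      y ⬝ᵥ (A *ᵥ (fun j => (z₀ j : ℚ)) - fun i => (b i : ℚ)) ≤ 0 ∧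
      (fun j => (α' j : ℚ)) ≤ y ᵥ* A ∧ y ᵥ* A ≤ fun j => (β' j : ℚ) := by
    intro U
    induction U using Finset.induction_on with
    | empty => exact ⟨α, β, y, le_rfl, le_rfl, by simp, hy, hcompl, hα, hβ⟩
    | insert s U hs ih =>
      obtain ⟨α', β', y, hαα, hββ, hU, hy, hcompl, hα, hβ⟩ := ih
      set k := ⌊(y ᵥ* A) s⌋
      have hk0 : (k : ℚ) ≤ (y ᵥ* A) s := Int.floor_le _
      have hk1 : (y ᵥ* A) s < k + 1 := Int.lt_floor_add_one _
      have hαk : α' s ≤ k := Int.le_floor.2 (hα s)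
      have hβk : k ≤ β' s := by
        have : (k : ℚ) ≤ β' s := hk0.trans (hβ s)
        exact_mod_cast this
      have hαβ : α' ≤ β' := fun j => by
        have : (α' j : ℚ) ≤ β' j := (hα j).trans (hβ j)
        exact_mod_cast this
      have hle : Function.update α' s k ≤ Function.update β' s k := by
        intro j
        by_cases hj : j = s
        · subst hj; simp
        · simpa [hj] using hαβ j
      obtain ⟨y', hy', hcompl', hα', hβ'⟩ := hbox.exists_multiplier hz₀ hle (by
        intro z hz hd
        have h0 := vecMul_dotProduct_sub_nonneg hy hcompl hz
        have hterm : ∀ j, (y ᵥ* A) j * ((z j : ℚ) - z₀ j) -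
            (Pi.single s (((y ᵥ* A) s - k) * ((z s : ℚ) - z₀ s)) : κ → ℚ) j ≤
            (max (Function.update β' s k j * (z j - z₀ j))
              (Function.update α' s k j * (z j - z₀ j)) : ℤ) := by
          intro j
          by_cases hj : j = s
          · subst hj
            simp only [Pi.single_eq_same, Function.update_self, max_self]
            push_cast
            linarith
          · simp only [Pi.single_eq_of_ne hj, Function.update_of_ne hj, sub_zero]
            push_cast
            rcases le_total 0 ((z j : ℚ) - z₀ j) with h | h
            · exact le_max_of_le_left (mul_le_mul_of_nonneg_right (hβ j) h)
            · exact le_max_of_le_right (mul_le_mul_of_nonpos_right (hα j) h)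
        have hsum := Finset.sum_le_sum fun j (_ : j ∈ Finset.univ) => hterm j
        rw [Finset.sum_sub_distrib, Finset.sum_pi_single'] at hsum
        simp only [Finset.mem_univ, if_true] at hsum
        simp only [dotProduct, Pi.sub_apply] at h0
        have hds : (z s : ℚ) - z₀ s ≤ 1 := by exact_mod_cast (abs_le.1 (hd s)).2
        have hlt1 : ((y ᵥ* A) s - k) * ((z s : ℚ) - z₀ s) < 1 := by
          have := mul_le_mul_of_nonneg_left hds (sub_nonneg.2 hk0)
          linarith
        rw [← Int.cast_sum] at hsum
        have : (-1 : ℚ) < ((∑ j, max (Function.update β' s k j * (z j - z₀ j))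
              (Function.update α' s k j * (z j - z₀ j)) : ℤ) : ℚ) := by linarith
        have : (-1 : ℤ) < ∑ j, max (Function.update β' s k j * (z j - z₀ j))
              (Function.update α' s k j * (z j - z₀ j)) := by exact_mod_cast this
        omega)
      refine ⟨Function.update α' s k, Function.update β' s k, y', ?_, ?_, ?_, hy', hcompl', hα',
        hβ'⟩
      · intro j
        by_cases hj : j = s
        · subst hj; simpa using (hαα j).trans hαk
        · simpa [hj] using hαα j
      · intro j
        by_cases hj : j = s
        · subst hj; simpa using hβk.trans (hββ j)
        · simpa [hj] using hββ j
      · intro j hj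
        by_cases hjs : j = s
        · subst hjs; simp
        · simpa [hjs] using hU j ((Finset.mem_insert.1 hj).resolve_left hjs)
  obtain ⟨c, c', y, hαc, hcβ, hU, hy, hcompl, hcy, hyc⟩ := key Finset.univ
  obtain rfl : c = c' := funext fun s => hU s (Finset.mem_univ s)
  have hyA : y ᵥ* A = fun j => (c j : ℚ) := le_antisymm hyc hcy
  have htdi := hbox (fun j => (z₀ j : ℚ) - 1) (fun j => (z₀ j : ℚ) + 1) (fun j => by
    simp only; linarith)
  have hfeas : Sum.elim y (Sum.elim 0 0) ᵥ* boxMatrix A = fun j => (c j : ℚ) := by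
    rw [vecMul_boxMatrix, add_zero, sub_zero, hyA]
  have hfeas0 : 0 ≤ Sum.elim y (Sum.elim (0 : κ → ℚ) (0 : κ → ℚ)) := by
    rintro (i | i | i)
    exacts [hy i, le_rfl, le_rfl]
  obtain ⟨w, hw, hwA, hopt, -⟩ := htdi.exists_optimal c (x₀ := fun j => (z₀ j : ℚ))
    ((boxRHS_le_iff _ _ _ _ _).2 ⟨hz₀, fun j => by simp only; linarith,
      fun j => by simp only; linarith⟩) ⟨_, hfeas0, hfeas⟩
  have hval := hopt _ hfeas0 hfeas
  obtain ⟨y', u, v, rfl⟩ : ∃ (y' : ι → ℤ) (u v : κ → ℤ), w = Sum.elim y' (Sum.elim u v) := by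
    refine ⟨w ∘ Sum.inl, w ∘ Sum.inr ∘ Sum.inl, w ∘ Sum.inr ∘ Sum.inr, ?_⟩
    funext i
    rcases i with i | i | i <;> rfl
  have hcast : (fun i => ((Sum.elim y' (Sum.elim u v) i : ℤ) : ℚ)) =
      Sum.elim (fun i => (y' i : ℚ)) (Sum.elim (fun j => (u j : ℚ)) fun j => (v j : ℚ)) := by
    funext i
    rcases i with i | i | i <;> rfl
  rw [hcast] at hwA hval
  rw [vecMul_boxMatrix] at hwA
  have hy' : ∀ i, (0 : ℚ) ≤ y' i := fun i => by exact_mod_cast hw (Sum.inl i)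
  have hu : ∀ j, (0 : ℚ) ≤ u j := fun j => by exact_mod_cast hw (Sum.inr (Sum.inl j))
  have hv : ∀ j, (0 : ℚ) ≤ v j := fun j => by exact_mod_cast hw (Sum.inr (Sum.inr j))
  have hweak := dotProduct_le_vecMul_dotProduct (y := fun i => (y' i : ℚ)) hy' hz₀
  have hcz := congrArg (fun r => r ⬝ᵥ fun j => (z₀ j : ℚ)) hwA
  rw [dotProduct_sub, Matrix.dotProduct_mulVec, hyA] at hcompl
  simp only [sub_dotProduct, add_dotProduct] at hcz
  simp only [boxRHS, dotProduct, Fintype.sum_sum_type, Sum.elim_inl, Sum.elim_inr, mul_sub,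
    mul_add, mul_neg, mul_one, Finset.sum_sub_distrib, Finset.sum_add_distrib, Pi.zero_apply,
    zero_mul, Finset.sum_const_zero, add_zero, Finset.sum_neg_distrib, neg_add,
    sub_zero, neg_zero] at hval hcompl hcz hweak
  have hu0 : 0 ≤ ∑ j, (u j : ℚ) := Finset.sum_nonneg fun j _ => hu j
  have hv0 : 0 ≤ ∑ j, (v j : ℚ) := Finset.sum_nonneg fun j _ => hv j
  have hus : ∑ j, (u j : ℚ) = 0 := by linarith
  have hvs : ∑ j, (v j : ℚ) = 0 := by linarith
  rw [Finset.sum_eq_zero_iff_of_nonneg fun j _ => hu j] at hus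
  rw [Finset.sum_eq_zero_iff_of_nonneg fun j _ => hv j] at hvs
  have hufun : (fun j => (u j : ℚ)) = 0 := funext fun j => hus j (Finset.mem_univ j)
  have hvfun : (fun j => (v j : ℚ)) = 0 := funext fun j => hvs j (Finset.mem_univ j)
  have hy'A : (fun i => (y' i : ℚ)) ᵥ* A = fun j => (c j : ℚ) := by
    rwa [hufun, hvfun, add_zero, sub_zero] at hwA
  refine ⟨y', fun i => hw (Sum.inl i), ?_, ?_, ?_⟩
  · rw [dotProduct_sub, Matrix.dotProduct_mulVec, hy'A]
    simp only [dotProduct]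
    have hus' : ∀ x : κ → ℚ, ∑ j, (u j : ℚ) * x j = 0 := fun x =>
      Finset.sum_eq_zero fun j hj => by rw [hus j hj, zero_mul]
    have hvs' : ∀ x : κ → ℚ, ∑ j, (v j : ℚ) * x j = 0 := fun x =>
      Finset.sum_eq_zero fun j hj => by rw [hvs j hj, zero_mul]
    linarith [hus' fun j => (z₀ j : ℚ), hvs' fun j => (z₀ j : ℚ)]
  · rw [hy'A]
    exact fun j => Int.cast_le.2 (hαc j)
  · rw [hy'A]
    exact fun j => Int.cast_le.2 (hcβ j)

/-- The set of integral points of a box-TDI polyhedron has no gaps in any coordinate. -/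
theorem IsBoxTDI.exists_int_coord_eq {ι κ : Type} [Fintype ι] [Fintype κ] [DecidableEq κ]
    {A : Matrix ι κ ℚ} {b : ι → ℤ} (hbox : IsBoxTDI A fun i => (b i : ℚ)) {z z' : κ → ℤ}
    (hz : (fun i => (b i : ℚ)) ≤ A *ᵥ fun j => (z j : ℚ))
    (hz' : (fun i => (b i : ℚ)) ≤ A *ᵥ fun j => (z' j : ℚ)) (s : κ) {k : ℤ}
    (hk : z s ≤ k) (hk' : k ≤ z' s) :
    ∃ r : κ → ℤ, ((fun i => (b i : ℚ)) ≤ A *ᵥ fun j => (r j : ℚ)) ∧ r s = k := by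
  rcases eq_or_lt_of_le (hk.trans hk') with h | h
  · exact ⟨z, hz, by omega⟩
  have hkq : (z s : ℚ) ≤ k := by exact_mod_cast hk
  have hkq' : (k : ℚ) ≤ z' s := by exact_mod_cast hk'
  have hd : (0 : ℚ) < z' s - z s := sub_pos.2 (by exact_mod_cast h)
  obtain ⟨l, hl0, hl1, hl⟩ : ∃ l : ℚ, 0 ≤ l ∧ l ≤ 1 ∧ (1 - l) * z s + l * z' s = k := by
    refine ⟨(k - z s) / (z' s - z s), div_nonneg (by linarith) hd.le,
      (div_le_one hd).2 (by linarith), ?_⟩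
    field_simp
    ring
  have hl1' : 0 ≤ 1 - l := sub_nonneg.2 hl1
  obtain ⟨r, hr, hfr, hgr, -⟩ := hbox.exists_int_le 0
    (Function.update (z ⊓ z') s k) (Function.update (z ⊔ z') s k)
    (x₀ := (1 - l) • (fun j => (z j : ℚ)) + l • fun j => (z' j : ℚ)) (by
      intro i
      rw [Matrix.mulVec_add, Matrix.mulVec_smul, Matrix.mulVec_smul]
      have h1 := mul_le_mul_of_nonneg_left (hz i) hl1'
      have h2 := mul_le_mul_of_nonneg_left (hz' i) hl0
      simp only [Pi.add_apply, Pi.smul_apply, smul_eq_mul]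
      linarith) (by
      intro j
      simp only [Pi.add_apply, Pi.smul_apply, smul_eq_mul]
      by_cases hj : j = s
      · subst hj; simp [hl]
      · simp only [Function.update_of_ne hj, Pi.inf_apply]
        push_cast
        have h1 := mul_le_mul_of_nonneg_left (min_le_left (z j : ℚ) (z' j)) hl1'
        have h2 := mul_le_mul_of_nonneg_left (min_le_right (z j : ℚ) (z' j)) hl0
        linarith) (by
      intro j
      simp only [Pi.add_apply, Pi.smul_apply, smul_eq_mul]
      by_cases hj : j = s
      · subst hj; simp [hl]
      · simp only [Function.update_of_ne hj, Pi.sup_apply]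
        push_cast
        have h1 := mul_le_mul_of_nonneg_left (le_max_left (z j : ℚ) (z' j)) hl1'
        have h2 := mul_le_mul_of_nonneg_left (le_max_right (z j : ℚ) (z' j)) hl0
        linarith)
  refine ⟨r, hr, le_antisymm ?_ ?_⟩
  · simpa using hgr s
  · simpa using hfr s

/-- A discrete convex function grows at least linearly to the right on an interval of finiteness. -/
theorem add_mul_le_of_discrete_convex {ψ : ℤ → WithTop ℤ}
    (hconv : ∀ k, ψ k ≠ ⊤ → ψ k + ψ k ≤ ψ (k - 1) + ψ (k + 1)) {k₀ w : ℤ}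
    (hw : ψ k₀ + (w : WithTop ℤ) ≤ ψ (k₀ + 1)) (n : ℕ)
    (hfin : ∀ k, k₀ ≤ k → k ≤ k₀ + n → ψ k ≠ ⊤) :
    ψ k₀ + ((w * n : ℤ) : WithTop ℤ) ≤ ψ (k₀ + n) ∧
      ψ (k₀ + n) + (w : WithTop ℤ) ≤ ψ (k₀ + n + 1) := by
  induction n with
  | zero => simpa using hw
  | succ n ih =>
    obtain ⟨ih₁, ih₂⟩ := ih fun k h1 h2 => hfin k h1 (by push_cast; omega)
    have h0 := hfin k₀ le_rfl (by omega)
    have h1 := hfin (k₀ + n) (by omega) (by push_cast; omega)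
    have h2 := hfin (k₀ + n + 1) (by omega) (by push_cast; omega)
    have hc := hconv _ h2
    have e : k₀ + ((n + 1 : ℕ) : ℤ) = k₀ + n + 1 := by push_cast; ring
    rw [e]
    rw [add_sub_cancel_right] at hc
    obtain ⟨a, ha⟩ := WithTop.ne_top_iff_exists.1 h0
    obtain ⟨b, hb⟩ := WithTop.ne_top_iff_exists.1 h1
    obtain ⟨c, hc'⟩ := WithTop.ne_top_iff_exists.1 h2
    rw [← ha, ← hb] at ih₁
    rw [← hb, ← hc'] at ih₂
    rw [← hb, ← hc'] at hc
    rw [← ha, ← hc']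
    norm_cast at ih₁ ih₂ ⊢
    refine ⟨by push_cast; linarith, ?_⟩
    cases hd : ψ (k₀ + n + 1 + 1) with
    | top => exact le_top
    | coe d =>
      rw [hd] at hc
      norm_cast at hc ⊢
      linarith

/-- A discrete convex function is bounded below by its subgradient at `k₀` at every point that is
joined to `k₀` by an interval of finiteness. -/
theorem add_mul_sub_le_of_discrete_convex {ψ : ℤ → WithTop ℤ}
    (hconv : ∀ k, ψ k ≠ ⊤ → ψ k + ψ k ≤ ψ (k - 1) + ψ (k + 1)) {k₀ w k : ℤ}
    (hleft : ψ k₀ ≤ ψ (k₀ - 1) + (w : WithTop ℤ)) (hright : ψ k₀ + (w : WithTop ℤ) ≤ ψ (k₀ + 1))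
    (hfin : ∀ j, min k₀ k ≤ j → j ≤ max k₀ k → ψ j ≠ ⊤) :
    ψ k₀ + ((w * (k - k₀) : ℤ) : WithTop ℤ) ≤ ψ k := by
  rcases le_total k₀ k with h | h
  · obtain ⟨n, rfl⟩ := Int.le.dest h
    have := (add_mul_le_of_discrete_convex hconv hright n fun j h1 h2 =>
      hfin j (by omega) (by omega)).1
    simpa using this
  · obtain ⟨n, hn⟩ := Int.le.dest h
    have hleft' : ψ k₀ + ((-w : ℤ) : WithTop ℤ) ≤ ψ (k₀ - 1) := by
      have h0 := hfin k₀ (by omega) (by omega)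
      obtain ⟨a, ha⟩ := WithTop.ne_top_iff_exists.1 h0
      rw [← ha] at hleft ⊢
      cases hd : ψ (k₀ - 1) with
      | top => exact le_top
      | coe d =>
        rw [hd] at hleft
        norm_cast at hleft ⊢
        linarith
    have := (add_mul_le_of_discrete_convex (ψ := fun j => ψ (-j)) (k₀ := -k₀) (w := -w)
      (by
        intro j hj
        have := hconv _ hj
        rw [add_comm (ψ (-j - 1))] at this
        rwa [show -(j - 1) = -j + 1 by ring, show -(j + 1) = -j - 1 by ring])
      (by rwa [neg_neg, show -(-k₀ + 1) = k₀ - 1 by ring]) n fun j h1 h2 =>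
      hfin (-j) (by omega) (by omega)).1
    rw [neg_neg, show -(-k₀ + (n : ℤ)) = k by omega] at this
    rwa [show w * (k - k₀) = -w * n by rw [← hn]; ring]

/-- Integral slopes of a discrete convex function on both sides of a point, with arbitrary slopes
taken towards infinite values. -/
theorem exists_slopes {u v : WithTop ℤ} {r : ℤ} (h : (r : WithTop ℤ) + r ≤ u + v) :
    ∃ a b : ℤ, a ≤ b ∧ (u ≠ ⊤ → u = (r - a : ℤ)) ∧ (v ≠ ⊤ → v = (r + b : ℤ)) := by
  cases u with
  | top =>
    cases v with
    | top => exact ⟨0, 0, le_rfl, by simp, by simp⟩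
    | coe v => exact ⟨v - r, v - r, le_rfl, by simp, by simp⟩
  | coe u =>
    cases v with
    | top => exact ⟨r - u, r - u, le_rfl, by simp, by simp⟩
    | coe v =>
      norm_cast at h
      exact ⟨r - u, v - r, by linarith, by simp, by simp⟩

/-- **optimality criteria.** With `Q x ≥ p` box-TDI defining a nonempty
integral polyhedron `R` and `Φ` an integer-valued separable discrete convex function finite
on `⊙R = R ∩ ℤ^S`, an element `z* ∈ ⊙R` is a `Φ`-minimizer iff there is a nonnegative
integral vector `y*` with `y*(Q z* - p) = 0` and `Φ'(z* - 1) ≤ y* Q ≤ Φ'(z*)`. -/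
theorem minimizer_iff_optimality_criteria {m : ℕ} {S : Type} [Fintype S] [DecidableEq S]
    (Q : Matrix (Fin m) S ℤ) (p : Fin m → ℤ)
    (φ : S → ℤ → WithTop ℤ)
    (hconv : ∀ s, ∀ k : ℤ, φ s k ≠ ⊤ → φ s k + φ s k ≤ φ s (k - 1) + φ s (k + 1))
    (hbox : IsBoxTDI (Q.map (Int.cast : ℤ → ℚ)) fun i => (p i : ℚ))
    (hne : ∃ x : S → ℚ, memR Q p x)
    (hint : {x : S → ℚ | memR Q p x} =
      convexHull ℚ {x : S → ℚ | memR Q p x ∧ ∀ s, ∃ k : ℤ, x s = k})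
    (hfin : ∀ z : S → ℤ, memR Q p (fun s => (z s : ℚ)) → ∀ s, φ s (z s) ≠ ⊤)
    (zstar : S → ℤ) (hzstar : memR Q p fun s => (zstar s : ℚ)) :
    (∀ z : S → ℤ, memR Q p (fun s => (z s : ℚ)) → PhiSum φ zstar ≤ PhiSum φ z) ↔
      ∃ ystar : Fin m → ℤ, 0 ≤ ystar ∧ ystar ⬝ᵥ (Q *ᵥ zstar - p) = 0 ∧
        (∀ s, φ s (zstar s) ≤ φ s (zstar s - 1) + (((ystar ᵥ* Q) s : ℤ) : WithTop ℤ) ∧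
          φ s (zstar s) + (((ystar ᵥ* Q) s : ℤ) : WithTop ℤ) ≤ φ s (zstar s + 1)) := by
  have hpoly : ∀ z : S → ℤ, ∀ i,
      ((Q.map (Int.cast : ℤ → ℚ)) *ᵥ fun s => (z s : ℚ)) i = ((Q *ᵥ z) i : ℤ) := by
    intro z i
    simp [Matrix.mulVec, dotProduct]
  have hdual : ∀ (y : Fin m → ℤ) s,
      ((fun i => (y i : ℚ)) ᵥ* (Q.map (Int.cast : ℤ → ℚ))) s = ((y ᵥ* Q) s : ℤ) := by
    intro y s
    simp [Matrix.vecMul, dotProduct]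
  have hslack : ∀ y : Fin m → ℤ, (fun i => (y i : ℚ)) ⬝ᵥ ((Q.map (Int.cast : ℤ → ℚ)) *ᵥ
      (fun s => (zstar s : ℚ)) - fun i => (p i : ℚ)) = ((y ⬝ᵥ (Q *ᵥ zstar - p) : ℤ) : ℚ) := by
    intro y
    simp only [dotProduct, Pi.sub_apply, hpoly]
    push_cast
    rfl
  choose r hr using fun s => WithTop.ne_top_iff_exists.1 (hfin zstar hzstar s)
  have hΦstar : PhiSum φ zstar = ((∑ s, r s : ℤ) : WithTop ℤ) := by
    simp [PhiSum, ← hr]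
  constructor
  · intro hmin
    have hs : ∀ s, ∃ a b : ℤ, a ≤ b ∧ (φ s (zstar s - 1) ≠ ⊤ →
        φ s (zstar s - 1) = (r s - a : ℤ)) ∧
        (φ s (zstar s + 1) ≠ ⊤ → φ s (zstar s + 1) = (r s + b : ℤ)) := fun s => by
      have := hconv s _ (hfin zstar hzstar s)
      rw [← hr] at this
      exact exists_slopes this
    choose a b hab ha hb using hs
    obtain ⟨y₀, hy₀, hcompl₀, ha₀, hb₀⟩ := hbox.exists_multiplier hzstar hab (by
      intro z hz hd
      have hterm : ∀ s, φ s (z s) = ((r s + max (b s * (z s - zstar s))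
          (a s * (z s - zstar s)) : ℤ) : WithTop ℤ) := by
        intro s
        have hf := hfin z hz s
        have habs := hab s
        have := abs_le.1 (hd s)
        obtain h | h | h : z s = zstar s - 1 ∨ z s = zstar s ∨ z s = zstar s + 1 := by omega
        · rw [h] at hf ⊢
          rw [ha s hf, show zstar s - 1 - zstar s = -1 by ring, max_eq_right (by omega)]
          congr 1
          ring
        · rw [h, sub_self, mul_zero, mul_zero, max_self, add_zero, hr]
        · rw [h] at hf ⊢
          rw [hb s hf, show zstar s + 1 - zstar s = 1 by ring, max_eq_left (by omega), mul_one]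
      have hle := hmin z hz
      have hΦ : PhiSum φ z = ((∑ s, (r s + max (b s * (z s - zstar s))
          (a s * (z s - zstar s))) : ℤ) : WithTop ℤ) := by
        simp only [PhiSum, hterm]
        exact (map_sum (WithTop.addHom : ℤ →+ WithTop ℤ) _ _).symm
      rw [hΦstar, hΦ, WithTop.coe_le_coe, Finset.sum_add_distrib] at hle
      linarith)
    obtain ⟨y, hy, hcompl, hay, hyb⟩ :=
      hbox.exists_int_multiplier hzstar y₀ hy₀ hcompl₀ ha₀ hb₀
    have hz0 : (0 : Fin m → ℤ) ≤ Q *ᵥ zstar - p := by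
      intro i
      have := hzstar i
      rw [hpoly] at this
      exact sub_nonneg.2 (Int.cast_le.1 this)
    refine ⟨y, hy, le_antisymm ?_ (dotProduct_nonneg_of_nonneg hy hz0), fun s => ⟨?_, ?_⟩⟩
    · rw [hslack] at hcompl
      exact_mod_cast hcompl
    · have h1 := hay s
      rw [hdual, Int.cast_le] at h1
      by_cases hf : φ s (zstar s - 1) = ⊤
      · simp [hf]
      · rw [ha s hf, ← hr]
        norm_cast
        linarith
    · have h1 := hyb s
      rw [hdual, Int.cast_le] at h1
      by_cases hf : φ s (zstar s + 1) = ⊤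
      · simp [hf]
      · rw [hb s hf, ← hr]
        norm_cast
        linarith
  · rintro ⟨y, hy, hcompl, hslope⟩ z hz
    have hle : ∀ s, ((r s + (y ᵥ* Q) s * (z s - zstar s) : ℤ) : WithTop ℤ) ≤ φ s (z s) := by
      intro s
      have := add_mul_sub_le_of_discrete_convex (hconv s) (k := z s) (hslope s).1 (hslope s).2 (by
        intro j h1 h2
        rcases le_total (zstar s) (z s) with h | h
        · obtain ⟨x, hx, rfl⟩ := hbox.exists_int_coord_eq hzstar hz s (k := j)
            (by omega) (by omega)
          exact hfin x hx s
        · obtain ⟨x, hx, rfl⟩ := hbox.exists_int_coord_eq hz hzstar s (k := j)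
            (by omega) (by omega)
          exact hfin x hx s)
      rwa [← hr] at this
    have hnonneg := vecMul_dotProduct_sub_nonneg (y := fun i => (y i : ℚ))
      (fun i => by simpa using hy i) (by rw [hslack, hcompl, Int.cast_zero]) hz
    have hnonneg' : 0 ≤ ∑ s, (y ᵥ* Q) s * (z s - zstar s) := by
      simp only [dotProduct, hdual, Pi.sub_apply] at hnonneg
      exact_mod_cast hnonneg
    calc PhiSum φ zstar = ((∑ s, r s : ℤ) : WithTop ℤ) := hΦstar
      _ ≤ ((∑ s, (r s + (y ᵥ* Q) s * (z s - zstar s)) : ℤ) : WithTop ℤ) := by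
        rw [WithTop.coe_le_coe, Finset.sum_add_distrib]
        linarith
      _ = ∑ s, ((r s + (y ᵥ* Q) s * (z s - zstar s) : ℤ) : WithTop ℤ) :=
        map_sum (WithTop.addHom : ℤ →+ WithTop ℤ) _ _
      _ ≤ PhiSum φ z := Finset.sum_le_sum fun s _ => hle s
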